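/- arXiv:2312.00928 — 2 statements merged into one kernel-verified Lean document; each statement's English description precedes it below -/
import Mathlib

section
/- Let C be a cycle on n ≥ 4 vertices and let h be the hatness function assigning hatness 2 to one vertex of C and hatness 4 to every other vertex. Then the game ⟨C,h⟩ is losing. -/
/-- The hat guessing game `⟨G, h⟩` is *winning*: there exists a strategy (one
deterministic guessing function per vertex, depending only on the colors of the
neighboring vertices) such that for every assignment of hat colors at least one
vertex guesses its own color correctly. -/
def HatGame.Winning {V : Type*} (G : SimpleGraph V) (h : V → ℕ) : Prop :=
  ∃ s : ∀ v : V, (∀ u : V, Fin (h u)) → Fin (h v),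
    (∀ (v : V) (c c' : ∀ u : V, Fin (h u)),
        (∀ u : V, G.Adj v u → c u = c' u) → s v c = s v c') ∧
    ∀ c : ∀ u : V, Fin (h u), ∃ v : V, s v c = c v

/-- The hat guessing number of `G`: the largest `q` such that the game on `G`
where every vertex has hatness `q` is winning. -/
noncomputable def HatGame.number {V : Type*} (G : SimpleGraph V) : ℕ :=
  sSup {q : ℕ | HatGame.Winning G (fun _ => q)}

/-- A cactus graph: a connected graph in which every pair of (distinct) cycles
shares at most one vertex. -/
def SimpleGraph.IsCactus {V : Type*} (G : SimpleGraph V) : Prop :=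
  G.Connected ∧
    ∀ (v w : V) (c₁ : G.Walk v v) (c₂ : G.Walk w w), c₁.IsCycle → c₂.IsCycle →
      {e | e ∈ c₁.edges} ≠ {e | e ∈ c₂.edges} →
      ({x | x ∈ c₁.support} ∩ {x | x ∈ c₂.support} : Set V).Subsingleton

namespace HatGame

open Finset

/-- The colors `c` that are excluded by the guess `φ`, when the color seen by `φ` ranges over
`A c`. -/
def excluded (A : Fin 4 → Finset (Fin 4)) (φ : Fin 4 → Fin 4) : Finset (Fin 4) :=
  univ.filter fun c => ∀ a ∈ A c, φ a = c

lemma mem_excluded {A : Fin 4 → Finset (Fin 4)} {φ : Fin 4 → Fin 4} {c : Fin 4} :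
    c ∈ excluded A φ ↔ ∀ a ∈ A c, φ a = c := by
  simp [excluded]

lemma mul_card_excluded_le {A : Fin 4 → Finset (Fin 4)} {q : ℕ} (hA : ∀ c, q ≤ #(A c))
    (φ : Fin 4 → Fin 4) : q * #(excluded A φ) ≤ 4 := by
  have hdisj : ∀ x ∈ excluded A φ, ∀ y ∈ excluded A φ, x ≠ y → Disjoint (A x) (A y) := by
    intro x hx y hy hxy
    rw [Finset.disjoint_left]
    intro a ha ha'
    exact hxy ((mem_excluded.1 hx a ha).symm.trans (mem_excluded.1 hy a ha'))
  have h₁ := Finset.card_biUnion hdisj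
  have h₂ := Finset.card_nsmul_le_sum (excluded A φ) (fun c => #(A c)) q fun c _ => hA c
  have h₃ := Finset.card_le_univ ((excluded A φ).biUnion A)
  simp only [Fintype.card_fin, smul_eq_mul] at h₂ h₃
  rw [mul_comm]
  omega

/-- Along a path of vertices of hatness 4, whose first vertex has color `c₀` and guesses
according to `g`, and whose later vertices guess according to `F`: the colors of the
`(j + 1)`-st vertex compatible with color `d` of the `(j + 2)`-nd one, if all the vertices up to
the `(j + 1)`-st guess wrong. -/
def reachable (c₀ : Fin 4) (g : Fin 4 → Fin 4) (F : ℕ → Fin 4 → Fin 4 → Fin 4) :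
    ℕ → Fin 4 → Finset (Fin 4)
  | 0, d => (univ.filter fun a => g a ≠ c₀).erase (F 0 c₀ d)
  | j + 1, d => (excluded (reachable c₀ g F j) fun a => F (j + 1) a d)ᶜ

lemma exists_coloring_of_mem_reachable {c₀ : Fin 4} {g : Fin 4 → Fin 4}
    {F : ℕ → Fin 4 → Fin 4 → Fin 4} {j : ℕ} {a d : Fin 4} (h : a ∈ reachable c₀ g F j d) :
    ∃ c : ℕ → Fin 4, c 0 = c₀ ∧ c (j + 1) = a ∧ c (j + 2) = d ∧ g (c 1) ≠ c 0 ∧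
      ∀ i ≤ j, F i (c i) (c (i + 2)) ≠ c (i + 1) := by
  induction j generalizing a d with
  | zero =>
    simp only [reachable, mem_erase, mem_filter, mem_univ, true_and] at h
    refine ⟨fun i => if i = 0 then c₀ else if i = 1 then a else d, by simp, by simp, by simp,
      by simpa using h.2, ?_⟩
    intro i hi
    obtain rfl : i = 0 := by omega
    simpa using h.1.symm
  | succ j ih =>
    simp only [reachable, mem_compl, mem_excluded, not_forall] at h
    obtain ⟨b, hb, hF⟩ := h
    obtain ⟨c, h0, h1, h2, hg, hc⟩ := ih hb
    refine ⟨Function.update c (j + 3) d, ?_, ?_, ?_, ?_, ?_⟩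
    · rw [Function.update_of_ne (by omega), h0]
    · rw [Function.update_of_ne (by omega), h2]
    · rw [Function.update_self]
    · rwa [Function.update_of_ne (by omega), Function.update_of_ne (by omega)]
    · intro i hi
      rw [Function.update_of_ne (by omega : i ≠ j + 3),
        Function.update_of_ne (by omega : i + 1 ≠ j + 3)]
      rcases Nat.lt_or_ge j i with hlt | hle
      · obtain rfl : i = j + 1 := by omega
        rw [Function.update_self, h1, h2]
        exact hF
      · rw [Function.update_of_ne (by omega)]
        exact hc i hle

lemma card_excluded_reachable_le {c₀ : Fin 4} {g : Fin 4 → Fin 4}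
    (F : ℕ → Fin 4 → Fin 4 → Fin 4) (j : ℕ) (φ : Fin 4 → Fin 4)
    (hg : #(univ.filter fun a => g a = c₀) ≤ 2) :
    #(excluded (reachable c₀ g F j) φ) ≤ max 1 #(univ.filter fun a => g a = c₀) := by
  set α := #(univ.filter fun a => g a = c₀) with hα
  have hB : α + #(univ.filter fun a => g a ≠ c₀) = 4 := by
    simpa using Finset.card_filter_add_card_filter_not (s := univ) (fun a => g a = c₀)
  induction j generalizing φ with
  | zero =>
    set B := univ.filter fun a => g a ≠ c₀ with hBdef
    have hpick : ∀ c ∈ excluded (reachable c₀ g F 0) φ, ∀ a ∈ B, a ≠ F 0 c₀ c → φ a = c :=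
      fun c hc a ha hne => mem_excluded.1 hc a (by simpa [reachable, hne, hBdef] using ha)
    rcases Nat.lt_or_ge α 2 with h1 | h2
    · refine le_trans (Finset.card_le_one.2 fun x hx y hy => ?_) (le_max_left _ _)
      have hcard : 0 < #((B.erase (F 0 c₀ x)).erase (F 0 c₀ y)) := by
        have e₁ := Finset.pred_card_le_card_erase (s := B) (a := F 0 c₀ x)
        have e₂ := Finset.pred_card_le_card_erase (s := B.erase (F 0 c₀ x)) (a := F 0 c₀ y)
        omega
      obtain ⟨a, ha⟩ := Finset.card_pos.1 hcard
      simp only [mem_erase] at ha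
      exact (hpick x hx a ha.2.2 ha.2.1).symm.trans (hpick y hy a ha.2.2 ha.1)
    · have hsub : excluded (reachable c₀ g F 0) φ ⊆ B.image φ := by
        intro c hc
        have hcard : 0 < #(B.erase (F 0 c₀ c)) := by
          have e₁ := Finset.pred_card_le_card_erase (s := B) (a := F 0 c₀ c)
          omega
        obtain ⟨a, ha⟩ := Finset.card_pos.1 hcard
        simp only [mem_erase] at ha
        exact mem_image.2 ⟨a, ha.2, hpick c hc a ha.2 ha.1⟩
      have e₁ := Finset.card_le_card hsub
      have e₂ := Finset.card_image_le (s := B) (f := φ)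
      omega
  | succ j ih =>
    have hcol : ∀ d, 4 - max 1 α ≤ #(reachable c₀ g F (j + 1) d) := by
      intro d
      rw [reachable, Finset.card_compl, Fintype.card_fin]
      have := ih fun a => F (j + 1) a d
      omega
    have h := mul_card_excluded_le hcol φ
    rcases Nat.lt_or_ge α 2 with h1 | h2
    · rw [show max 1 α = 1 by omega] at h ⊢
      omega
    · rw [show max 1 α = 2 by omega] at h ⊢
      omega

/-- On a path of `j + 3` vertices of hatness 4, given two strategies differing only at the ends,
some colors of the ends can be completed to a disproving coloring for both strategies. -/
lemma exists_common_ends (j : ℕ) (g k : Fin 2 → Fin 4 → Fin 4)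
    (F : ℕ → Fin 4 → Fin 4 → Fin 4) :
    ∃ c₀ d : Fin 4, ∀ x, ∃ c : ℕ → Fin 4, c 0 = c₀ ∧ c (j + 2) = d ∧ g x (c 1) ≠ c 0 ∧
      (∀ i ≤ j, F i (c i) (c (i + 2)) ≠ c (i + 1)) ∧ k x (c (j + 1)) ≠ c (j + 2) := by
  have hsum : ∀ x, ∑ c₀, #(univ.filter fun a => g x a = c₀) = 4 := fun x => by
    simpa using (Finset.card_eq_sum_card_fiberwise (s := univ) (t := univ) (f := g x)
      fun _ _ => mem_coe.2 (mem_univ _)).symm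
  obtain ⟨c₀, hc₀⟩ : ∃ c₀, #(univ.filter fun a => g 0 a = c₀) +
      #(univ.filter fun a => g 1 a = c₀) ≤ 2 := by
    have h0 := hsum 0
    have h1 := hsum 1
    by_contra! hlt
    have := Finset.card_nsmul_le_sum univ (fun c₀ => #(univ.filter fun a => g 0 a = c₀) +
      #(univ.filter fun a => g 1 a = c₀)) 3 fun c _ => hlt c
    rw [Finset.sum_add_distrib, h0, h1] at this
    simp at this
  set E := fun x => excluded (reachable c₀ (g x) F j) (k x) with hE
  obtain ⟨d, hd⟩ : ∃ d, d ∉ E 0 ∪ E 1 := by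
    by_contra! hall
    have h0 := card_excluded_reachable_le (g := g 0) F j (k 0) (c₀ := c₀) (by omega)
    have h1 := card_excluded_reachable_le (g := g 1) F j (k 1) (c₀ := c₀) (by omega)
    have h2 := Finset.card_union_le (E 0) (E 1)
    rw [Finset.eq_univ_iff_forall.2 hall, Finset.card_univ, Fintype.card_fin] at h2
    simp only [hE] at h2
    omega
  refine ⟨c₀, d, fun x => ?_⟩
  have hx : d ∉ E x := by
    rw [mem_union, not_or] at hd
    fin_cases x
    · exact hd.1
    · exact hd.2
  simp only [hE, mem_excluded, not_forall] at hx
  obtain ⟨a, ha, hk⟩ := hx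
  obtain ⟨c, h0, h1, h2, hg, hc⟩ := exists_coloring_of_mem_reachable ha
  exact ⟨c, h0, h2, hg, hc, by rwa [h1, h2]⟩

lemma cycleGraph_adj_val_sub {n : ℕ} {a u v : Fin n}
    (h : (SimpleGraph.cycleGraph n).Adj v u) :
    (u - a).val = (v - a).val + 1 ∨ (v - a).val = (u - a).val + 1 ∨
      ((u - a).val = 0 ∧ (v - a).val + 1 = n) ∨ ((v - a).val = 0 ∧ (u - a).val + 1 = n) := by
  rw [SimpleGraph.cycleGraph_adj'] at h
  have key : ∀ x y : Fin n, (y ≤ x ∧ (x - y).val = x.val - y.val) ∨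
      (x < y ∧ (x - y).val = n + x.val - y.val) := fun x y => by
    rcases le_or_gt y x with h | h
    · exact Or.inl ⟨h, Fin.coe_sub_iff_le.2 h⟩
    · exact Or.inr ⟨h, Fin.coe_sub_iff_lt.2 h⟩
  have h₁ := key u a
  have h₂ := key v a
  have h₃ := key u v
  have h₄ := key v u
  simp only [Fin.le_def, Fin.lt_def] at h₁ h₂ h₃ h₄
  omega

/-- The coloring of the cycle with color `d` at `a`, and the colors `c 0, c 1, …` at the
vertices following `a`. -/
def cycleColoring {n : ℕ} (a : Fin n) (d : Fin 2) (c : ℕ → Fin 4) (u : Fin n) :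
    Fin (if u = a then 2 else 4) :=
  if h : u = a then Fin.cast (if_pos h).symm d
  else Fin.cast (if_neg h).symm (c ((u - a).val - 1))

lemma val_cycleColoring_self {n : ℕ} (a : Fin n) (d : Fin 2) (c : ℕ → Fin 4) :
    (cycleColoring a d c a).val = d.val := by
  simp [cycleColoring]

lemma val_cycleColoring_of_ne {n : ℕ} {a u : Fin n} (h : u ≠ a) (d : Fin 2) (c : ℕ → Fin 4) :
    (cycleColoring a d c u).val = (c ((u - a).val - 1)).val := by
  simp [cycleColoring, h]

lemma cycleColoring_congr {n : ℕ} {a u : Fin n} {d d' : Fin 2} {c c' : ℕ → Fin 4}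
    (hd : u = a → d = d') (hc : u ≠ a → c ((u - a).val - 1) = c' ((u - a).val - 1)) :
    cycleColoring a d c u = cycleColoring a d' c' u := by
  unfold cycleColoring
  split_ifs with h
  · rw [hd h]
  · rw [hc h]

end HatGame

/-- A cycle on `n ≥ 4` vertices with one vertex of hatness 2 and all other
vertices of hatness 4 is losing. -/
theorem cycle_two_four_losing (n : ℕ) [NeZero n] (hn : 4 ≤ n) (a : Fin n) :
    ¬ HatGame.Winning (SimpleGraph.cycleGraph n)
        (fun x => if x = a then 2 else 4) := by
  rintro ⟨s, hs, hwin⟩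
  obtain ⟨j, hj⟩ : ∃ j, n = j + 4 := ⟨n - 4, by omega⟩
  have hzero : ∀ u : Fin n, (u - a).val = 0 ↔ u = a := fun u => by
    rw [Fin.val_eq_zero_iff, sub_eq_zero]
  let w : ℕ → Fin n := fun t => a + Fin.ofNat n t
  have hw : ∀ v, w (v - a).val = v := fun v => by simp [w]
  let p : ℕ → Fin 2 → (ℕ → Fin 4) → Fin 4 := fun t d c =>
    Fin.ofNat 4 (s (w t) (HatGame.cycleColoring a d c)).val
  have hpw : ∀ v d c, p (v - a).val d c =
      Fin.ofNat 4 (s v (HatGame.cycleColoring a d c)).val := fun v d c =>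
    congrArg (fun u => Fin.ofNat 4 (s u (HatGame.cycleColoring a d c)).val) (hw v)
  have hp : ∀ v d c, v ≠ a → s v (HatGame.cycleColoring a d c) = HatGame.cycleColoring a d c v →
      p (v - a).val d c = c ((v - a).val - 1) := by
    intro v d c hv h
    rw [hpw, congrArg Fin.val h, HatGame.val_cycleColoring_of_ne hv]
    simp
  have hlocal : ∀ v d d' c c',
      (∀ u, (SimpleGraph.cycleGraph n).Adj v u → (u = a → d = d') ∧
        (u ≠ a → c ((u - a).val - 1) = c' ((u - a).val - 1))) →
      p (v - a).val d c = p (v - a).val d' c' := by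
    intro v d d' c c' h
    have := hs v _ _ fun u hu => HatGame.cycleColoring_congr (h u hu).1 (h u hu).2
    rw [hpw, hpw, congrArg Fin.val this]
  obtain ⟨c₀, e, hce⟩ := HatGame.exists_common_ends j (fun d y => p 1 d fun _ => y)
    (fun d y => p (j + 3) d fun _ => y)
    (fun i x y => p (i + 2) 0 fun l => if l = i then x else y)
  let d₀ : Fin 2 := Fin.ofNat 2
    ((s a (HatGame.cycleColoring a 0 fun l => if l = 0 then c₀ else e)).val + 1)
  obtain ⟨c, h0, h1, hg, hF, hk⟩ := hce d₀
  obtain ⟨v, hv⟩ := hwin (HatGame.cycleColoring a d₀ c)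
  by_cases hva : v = a
  · subst hva
    have hsame : s v (HatGame.cycleColoring v d₀ c) =
        s v (HatGame.cycleColoring v 0 fun l => if l = 0 then c₀ else e) := by
      refine hs v _ _ fun u hu => HatGame.cycleColoring_congr (fun h => ?_) fun h => ?_
      · exact absurd hu (by rw [h]; exact SimpleGraph.irrefl _)
      · have hadj := HatGame.cycleGraph_adj_val_sub (a := v) hu
        rw [(hzero v).2 rfl] at hadj
        have := mt (hzero u).1 h
        have hcases : (u - v).val - 1 = 0 ∨ (u - v).val - 1 = j + 2 := by omega
        rcases hcases with h' | h' <;> simp [h', h0, h1]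
    have hval := congrArg Fin.val hv
    rw [HatGame.val_cycleColoring_self, hsame] at hval
    have : d₀.val = ((s v (HatGame.cycleColoring v 0 fun l => if l = 0 then c₀ else e)).val + 1)
      % 2 := rfl
    omega
  · have hpv := hp v d₀ c hva hv
    have hv0 := mt (hzero v).1 hva
    have hvn := (v - a).isLt
    have hadj := fun u => HatGame.cycleGraph_adj_val_sub (a := a) (v := v) (u := u)
    have hcases : (v - a).val = 1 ∨ (v - a).val = j + 3 ∨ ∃ i ≤ j, (v - a).val = i + 2 := by
      by_cases h : (v - a).val = 1
      · exact Or.inl h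
      by_cases h' : (v - a).val = j + 3
      · exact Or.inr (Or.inl h')
      exact Or.inr (Or.inr ⟨(v - a).val - 2, by omega, by omega⟩)
    rcases hcases with ht | ht | ⟨i, hi, ht⟩
    · have := hlocal v d₀ d₀ c (fun _ => c 1) fun u hu => ⟨fun _ => rfl, fun hua => by
        have := hadj u hu
        have := mt (hzero u).1 hua
        rw [show (u - a).val - 1 = 1 by omega]⟩
      rw [ht] at this hpv
      exact hg (this.symm.trans hpv)
    · have := hlocal v d₀ d₀ c (fun _ => c (j + 1)) fun u hu => ⟨fun _ => rfl, fun hua => by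
        have := hadj u hu
        have := mt (hzero u).1 hua
        rw [show (u - a).val - 1 = j + 1 by omega]⟩
      rw [ht] at this hpv
      exact hk (this.symm.trans hpv)
    · have := hlocal v d₀ 0 c (fun l => if l = i then c i else c (i + 2)) fun u hu =>
        ⟨fun hua => by
          have := hadj u hu
          have := (hzero u).2 hua
          omega, fun hua => by
          have := hadj u hu
          have := mt (hzero u).1 hua
          have hcases : (u - a).val - 1 = i ∨ (u - a).val - 1 = i + 2 := by omega
          rcases hcases with h | h <;> simp [h]⟩
      rw [ht] at this hpv
      exact hF i hi (this.symm.trans hpv)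
end

section
/- Let G be a cactus graph containing at least two cycles. Then the hat guessing game ⟨G, ★3⟩, in which every vertex has hatness 3, is winning; in particular HG(G) ≥ 3. -/
/-- `G` contains at least two (distinct) triangles, i.e. two cycles of length 3
with different edge sets. -/
def SimpleGraph.HasTwoTriangles {V : Type*} (G : SimpleGraph V) : Prop :=
  ∃ (v w : V) (c₁ : G.Walk v v) (c₂ : G.Walk w w),
    c₁.IsCycle ∧ c₂.IsCycle ∧ c₁.length = 3 ∧ c₂.length = 3 ∧
    {e | e ∈ c₁.edges} ≠ {e | e ∈ c₂.edges}

/-- `G` contains at least two (distinct) cycles, i.e. two cycles with different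
edge sets. -/
def SimpleGraph.HasTwoCycles {V : Type*} (G : SimpleGraph V) : Prop :=
  ∃ (v w : V) (c₁ : G.Walk v v) (c₂ : G.Walk w w),
    c₁.IsCycle ∧ c₂.IsCycle ∧ {e | e ∈ c₁.edges} ≠ {e | e ∈ c₂.edges}

/-- `G` contains a cycle whose length is 4 or divisible by 3. -/
def SimpleGraph.HasGoodCycle {V : Type*} (G : SimpleGraph V) : Prop :=
  ∃ (v : V) (c : G.Walk v v), c.IsCycle ∧ (c.length = 4 ∨ 3 ∣ c.length)

/-- A strategy on `G` with three colors which is guaranteed to succeed somewhere in `S` as soon as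
the vertex `v` only receives the colors `0` and `1`. -/
def HatGame.HalfWinning {V : Type*} (G : SimpleGraph V) (S : Set V) (v : V) : Prop :=
  ∃ s : V → (V → Fin 3) → Fin 3,
    (∀ (u : V) (c c' : V → Fin 3), (∀ w, G.Adj u w → c w = c' w) → s u c = s u c') ∧
    ∀ c : V → Fin 3, c v ≠ 2 → ∃ u ∈ S, s u c = c u

namespace HatGame

variable {V : Type*} {G : SimpleGraph V}

/-- The first bit of a color. -/
def fstBit (x : Fin 3) : Fin 3 := if x = 2 then 1 else 0

/-- The second bit of a color. -/
def sndBit (x : Fin 3) : Fin 3 := if x = 1 then 1 else 0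

/-- The color with the given bits. -/
def ofBits (x y : Fin 3) : Fin 3 := if x = 1 then 2 else y

theorem fstBit_ne_two : ∀ x, fstBit x ≠ 2 := by decide

theorem sndBit_ne_two : ∀ x, sndBit x ≠ 2 := by decide

theorem ofBits_fstBit_sndBit : ∀ x, ofBits (fstBit x) (sndBit x) = x := by decide

theorem eq_sndBit_of_ne : ∀ x y : Fin 3, y ≠ 2 → 1 - sndBit x ≠ y → y = sndBit x := by decide

/-- Two half-winning sets meeting only in their special vertex give a winning game. -/
theorem HalfWinning.winning {S T : Set V} {v : V} (hS : HalfWinning G S v)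
    (hT : HalfWinning G T v) (h : ∀ u ∈ S, u ∈ T → u = v) : Winning G (fun _ => 3) := by
  classical
  obtain ⟨s, hs, hs'⟩ := hS
  obtain ⟨t, ht, ht'⟩ := hT
  refine ⟨fun u c => if u = v then ofBits (s v c) (t v c) else
    if u ∈ S then s u (Function.update c v (fstBit (c v)))
    else t u (Function.update c v (sndBit (c v))), ?_, ?_⟩
  · intro u c c' hc
    have key : ∀ f : Fin 3 → Fin 3, ∀ w, G.Adj u w →
        Function.update c v (f (c v)) w = Function.update c' v (f (c' v)) w := by
      intro f w hw
      by_cases hwv : w = v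
      · subst hwv
        simp [hc w hw]
      · simp [hwv, hc w hw]
    dsimp only
    split_ifs with huv huS
    · subst huv
      rw [hs u c c' hc, ht u c c' hc]
    · exact hs u _ _ (key fstBit)
    · exact ht u _ _ (key sndBit)
  · intro c
    have upd : ∀ x w, G.Adj v w → Function.update c v x w = c w := fun x w hw => by
      simp [hw.ne']
    obtain ⟨u, huS, hu⟩ := hs' (Function.update c v (fstBit (c v))) (by simp [fstBit_ne_two])
    by_cases huv : u = v
    · subst huv
      obtain ⟨w, hwT, hw⟩ := ht' (Function.update c u (sndBit (c u))) (by simp [sndBit_ne_two])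
      by_cases hwv : w = u
      · subst hwv
        refine ⟨w, ?_⟩
        rw [hs w _ c (upd _), Function.update_self] at hu
        rw [ht w _ c (upd _), Function.update_self] at hw
        simp [hu, hw, ofBits_fstBit_sndBit]
      · refine ⟨w, ?_⟩
        have hwS : w ∉ S := fun hwS => hwv (h w hwS hwT)
        simpa [hwv, hwS] using hw
    · refine ⟨u, ?_⟩
      simpa [huv, huS] using hu

/-- The special vertex of a half-winning set can be moved to a new neighbor. -/
theorem HalfWinning.insert {S : Set V} {v w : V} (hS : HalfWinning G S v) (hvw : G.Adj v w)
    (hw : w ∉ S) : HalfWinning G (insert w S) w := by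
  classical
  obtain ⟨s, hs, hs'⟩ := hS
  have hne := hvw.ne
  refine ⟨fun u c => if u = w then 1 - sndBit (c v) else if u = v then ofBits (s v c) (c w) else
    s u (Function.update c v (fstBit (c v))), ?_, ?_⟩
  · intro u c c' hc
    dsimp only
    split_ifs with huw huv
    · subst huw
      rw [hc v hvw.symm]
    · subst huv
      rw [hs u c c' hc, hc w hvw]
    · refine hs u _ _ fun x hx => ?_
      by_cases hxv : x = v
      · subst hxv
        simp [hc x hx]
      · simp [hxv, hc x hx]
  · intro c hcw
    by_cases h1 : 1 - sndBit (c v) = c w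
    · exact ⟨w, Set.mem_insert _ _, by simpa using h1⟩
    have h2 := eq_sndBit_of_ne _ _ hcw h1
    obtain ⟨u, huS, hu⟩ := hs' (Function.update c v (fstBit (c v))) (by simp [fstBit_ne_two])
    have huw : u ≠ w := fun e => hw (e ▸ huS)
    refine ⟨u, Set.mem_insert_of_mem _ huS, ?_⟩
    by_cases huv : u = v
    · subst huv
      rw [hs u _ c fun x hx => by simp [hx.ne'], Function.update_self] at hu
      simp [hne, hu, h2, ofBits_fstBit_sndBit]
    · simpa [huv, huw] using hu

/-- The special vertex of a half-winning set can be moved along a path leaving the set. -/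
theorem HalfWinning.of_isPath {x y : V} (p : G.Walk x y) (hp : p.IsPath) {S : Set V}
    (hS : HalfWinning G S x) (h : ∀ z ∈ p.support, z ∈ S → z = x) :
    HalfWinning G (S ∪ {z | z ∈ p.support}) y := by
  induction p generalizing S with
  | nil =>
    obtain ⟨s, hs, hs'⟩ := hS
    refine ⟨s, hs, fun c hc => ?_⟩
    obtain ⟨u, hu, hu'⟩ := hs' c hc
    exact ⟨u, Or.inl hu, hu'⟩
  | @cons x w y hxw p ih =>
    rw [SimpleGraph.Walk.cons_isPath_iff] at hp
    have hwS : w ∉ S := fun hw => hxw.ne' (h w (by simp) hw)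
    obtain ⟨s, hs, hs'⟩ := ih hp.1 (hS.insert hxw hwS) (by
      rintro z hz (rfl | hzS)
      · rfl
      · have hzx := h z (by simp [hz]) hzS
        exact absurd (hzx ▸ hz) hp.2)
    refine ⟨s, hs, fun c hc => ?_⟩
    obtain ⟨u, (rfl | hu) | hu, hu'⟩ := hs' c hc
    · exact ⟨u, Or.inr (by simp), hu'⟩
    · exact ⟨u, Or.inl hu, hu'⟩
    · exact ⟨u, Or.inr (by simpa using Or.inr hu), hu'⟩

/-- The guessing function used at the vertices of a cycle not adjacent to the special vertex. -/
def middleGuess (x y : Fin 3) : Fin 3 :=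
  if x = 0 ∧ y ≠ 0 then 2 else if x = 1 ∧ y = 2 then 1 else 0

/-- The possible colors of consecutive vertices when all guesses of type `middleGuess` fail. -/
def Admissible (x y : Fin 3) : Prop :=
  (x = 0 ∧ y = 2) ∨ (x = 1 ∧ y = 0) ∨ (x = 1 ∧ y = 1) ∨ (x = 2 ∧ y = 0)

instance : DecidableRel Admissible := fun x y => by
  unfold Admissible
  infer_instance

theorem Admissible.next : ∀ x y z : Fin 3, Admissible x y → middleGuess x z ≠ y →
    Admissible y z := by
  decide

theorem admissible_of_ne : ∀ x y : Fin 3, x ≠ 2 → (if y = 2 then 1 else 0) ≠ x →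
    Admissible x y := by
  decide

theorem Admissible.eq_one : ∀ x y : Fin 3, Admissible x y → (if x = 0 then 2 else 0) ≠ y →
    y = 1 := by
  decide

/-- A closed sequence of distinct vertices is half-winning at its starting vertex. -/
theorem HalfWinning.of_injOn {n : ℕ} (hn : 3 ≤ n) (w : ℕ → V) (hw : Set.InjOn w (Set.Iio n))
    (hwn : w n = w 0) (hadj : ∀ i < n, G.Adj (w i) (w (i + 1))) :
    HalfWinning G (w '' Set.Iio n) (w 0) := by
  classical
  obtain ⟨pos, hpos⟩ : ∃ pos : V → ℕ, ∀ i < n, pos (w i) = i :=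
    ⟨Function.invFunOn w (Set.Iio n), fun i hi => hw.leftInvOn_invFunOn hi⟩
  have hlast : G.Adj (w 0) (w (n - 1)) := by
    have := hadj (n - 1) (by omega)
    rw [Nat.sub_add_cancel (by omega), hwn] at this
    exact this.symm
  have hprev : ∀ i, 1 ≤ i → i < n → G.Adj (w i) (w (i - 1)) := fun i h1 hi => by
    have := hadj (i - 1) (by omega)
    rw [Nat.sub_add_cancel h1] at this
    exact this.symm
  refine ⟨fun u c =>
    if pos u < n ∧ w (pos u) = u then
      if pos u = 0 then (if c (w 1) ≠ 2 ∧ c (w (n - 1)) ≠ 1 then 0 else 1)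
      else if pos u = 1 then (if c (w 0) = 0 then 2 else if c (w 2) = 2 then 1 else 0)
      else if pos u = n - 1 then
        (if c (w 0) = 0 then 1 else if c (w (n - 2)) = 0 then 2 else 0)
      else middleGuess (c (w (pos u - 1))) (c (w (pos u + 1)))
    else 0, ?_, ?_⟩
  · intro u c c' hc
    dsimp only
    by_cases hu : pos u < n ∧ w (pos u) = u
    swap
    · simp only [if_neg hu]
    obtain ⟨i, hi, rfl⟩ : ∃ i < n, u = w i := ⟨pos u, hu.1, hu.2.symm⟩
    simp only [hpos i hi, hi, and_self, if_true]
    by_cases h0 : i = 0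
    · subst h0
      have := hc _ (hadj 0 hi)
      rw [zero_add] at this
      simp only [if_true, this, hc _ hlast]
    by_cases h1 : i = 1
    · subst h1
      have hnext : c (w 2) = c' (w 2) := hc _ (hadj 1 hi)
      have hzero : c (w 0) = c' (w 0) := hc _ (hprev 1 le_rfl hi)
      simp only [one_ne_zero, if_true, if_false, hnext, hzero]
    by_cases h2 : i = n - 1
    · subst h2
      have e : n - 1 - 1 = n - 2 := by omega
      have := hc _ (hprev (n - 1) (by omega) hi)
      rw [e] at this
      simp only [h0, h1, if_true, if_false, hc _ hlast.symm, this]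
    · simp only [h0, h1, h2, if_false, hc _ (hadj i hi), hc _ (hprev i (by omega) hi)]
  · intro c hc
    by_contra hcon
    push Not at hcon
    have lose : ∀ i < n, _ := fun i hi => hcon (w i) ⟨i, hi, rfl⟩
    have l0 := lose 0 (by omega)
    have l1 := lose 1 (by omega)
    have ll := lose (n - 1) (by omega)
    have lm : ∀ i, 2 ≤ i → i < n - 1 → middleGuess (c (w (i - 1))) (c (w (i + 1))) ≠ c (w i) := by
      intro i h2 hi
      have := lose i (by omega)
      simpa [hpos i (by omega), show i < n by omega, show i ≠ 0 by omega, show i ≠ 1 by omega,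
        show i ≠ n - 1 by omega] using this
    simp only [hpos 0 (by omega), show 0 < n by omega, and_self, if_true] at l0
    simp only [hpos 1 (by omega), show 1 < n by omega, and_self, if_true, one_ne_zero,
      if_false] at l1
    simp only [hpos (n - 1) (by omega), show n - 1 < n by omega, and_self, if_true,
      show n - 1 ≠ 0 by omega, show n - 1 ≠ 1 by omega, if_false] at ll
    by_cases hv : c (w 0) = 0
    · rw [if_pos hv] at l1 ll
      rw [if_pos ⟨l1.symm, ll.symm⟩] at l0
      exact l0 hv.symm
    rw [if_neg hv] at l1 ll
    have hv1 : c (w 0) = 1 := by omega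
    have hends : c (w 1) ≠ 2 ∧ c (w (n - 1)) ≠ 1 := by
      by_contra h
      rw [if_neg h] at l0
      exact l0 hv1.symm
    have inv : ∀ i, i + 2 < n → Admissible (c (w (i + 1))) (c (w (i + 2))) := by
      intro i
      induction i with
      | zero => exact fun _ => admissible_of_ne _ _ hends.1 l1
      | succ i ih =>
        intro hi
        exact (ih (by omega)).next _ _ _ (lm (i + 2) (by omega) (by omega))
    have hfin := inv (n - 3) (by omega)
    rw [show n - 3 + 1 = n - 2 by omega, show n - 3 + 2 = n - 1 by omega] at hfin
    exact hends.2 (hfin.eq_one _ _ ll)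

theorem HalfWinning.of_isCycle {v : V} (p : G.Walk v v) (hp : p.IsCycle) :
    HalfWinning G {x | x ∈ p.support} v := by
  have hinj : Set.InjOn p.getVert (Set.Iio p.length) := fun i hi j hj h =>
    hp.getVert_injOn' (by simp at hi ⊢; omega) (by simp at hj ⊢; omega) h
  have := HalfWinning.of_injOn (G := G) hp.three_le_length p.getVert hinj (by simp)
    fun i hi => p.adj_getVert_succ hi
  rw [p.getVert_zero] at this
  obtain ⟨s, hs, hs'⟩ := this
  refine ⟨s, hs, fun c hc => ?_⟩
  obtain ⟨_, ⟨i, -, rfl⟩, hu⟩ := hs' c hc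
  exact ⟨_, p.getVert_mem_support i, hu⟩

theorem HalfWinning.of_mem_isCycle {v x : V} (p : G.Walk v v) (hp : p.IsCycle)
    (hx : x ∈ p.support) : HalfWinning G {x | x ∈ p.support} x := by
  classical
  have := HalfWinning.of_isCycle (p.rotate x hx) (hp.rotate hx)
  simpa using this

/-- A game with more colors than vertices is losing. -/
theorem Winning.le_card [Fintype V] {q : ℕ} (h : Winning G (fun _ => q)) :
    q ≤ Fintype.card V := by
  classical
  obtain ⟨s, hs, hs'⟩ := h
  rcases Nat.eq_zero_or_pos q with rfl | hq
  · exact Nat.zero_le _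
  choose g hg using hs'
  let F : (V → Fin q) → Σ v : V, ({u // u ≠ v} → Fin q) := fun c => ⟨g c, fun u => c u⟩
  have hF : Function.Injective F := by
    intro c c' hcc
    have h1 : g c = g c' := congrArg Sigma.fst hcc
    have h2 : ∀ u, u ≠ g c → c u = c' u := by
      have key : ∀ (v v' : V) (hv : v = v') (a : {u // u ≠ v} → Fin q) (b : {u // u ≠ v'} → Fin q),
          (⟨v, a⟩ : Σ v : V, ({u // u ≠ v} → Fin q)) = ⟨v', b⟩ →
          ∀ u (hu : u ≠ v), a ⟨u, hu⟩ = b ⟨u, hv ▸ hu⟩ := by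
        rintro v _ rfl a b hab u hu
        simp only [Sigma.mk.injEq, heq_eq_eq, true_and] at hab
        rw [hab]
      exact fun u hu => key _ _ h1 _ _ hcc u hu
    funext u
    by_cases hu : u = g c
    · rw [hu, ← hg c, hs (g c) c c' fun w hw => h2 w hw.ne', h1, hg c']
    · exact h2 u hu
  have hle := Fintype.card_le_of_injective F hF
  simp only [Fintype.card_sigma, Fintype.card_fun, Fintype.card_fin, Fintype.card_subtype_compl,
    Fintype.card_subtype_eq, Finset.sum_const, Finset.card_univ, smul_eq_mul] at hle
  rcases Nat.eq_zero_or_pos (Fintype.card V) with h0 | h0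
  · simp [h0] at hle
  · obtain ⟨k, hk⟩ := Nat.exists_eq_succ_of_ne_zero h0.ne'
    rw [hk] at hle ⊢
    simp only [Nat.succ_eq_add_one, Nat.add_sub_cancel, pow_succ] at hle ⊢
    rw [mul_comm] at hle
    exact Nat.le_of_mul_le_mul_right hle (pow_pos hq k)

end HatGame

/-- A cactus graph with at least two cycles is winning when every vertex has
hatness 3; in particular its hat guessing number is at least 3. -/
theorem cactus_two_cycles_winning_three {V : Type*} [Fintype V]
    (G : SimpleGraph V) (hG : G.IsCactus) (hc : G.HasTwoCycles) :
    HatGame.Winning G (fun _ => 3) ∧ 3 ≤ HatGame.number G := by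
  have hwin : HatGame.Winning G (fun _ => 3) := by
    obtain ⟨hconn, hcact⟩ := hG
    obtain ⟨v, w, c₁, c₂, h₁, h₂, hne⟩ := hc
    obtain ⟨⟨x, y⟩, ⟨hx, hy⟩, hmin⟩ := Set.exists_min_image
      {q : V × V | q.1 ∈ c₁.support ∧ q.2 ∈ c₂.support} (fun q => G.dist q.1 q.2)
      (Set.toFinite _) ⟨(v, w), c₁.start_mem_support, c₂.start_mem_support⟩
    obtain ⟨p, hp, hlen⟩ := hconn.exists_path_of_dist x y
    have hpx : ∀ z ∈ p.support, z ∈ c₁.support → z = x := by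
      classical
      intro z hz hz₁
      have h := hmin (z, y) ⟨hz₁, hy⟩
      have h' := SimpleGraph.dist_le (p.dropUntil z hz)
      have h'' := congrArg SimpleGraph.Walk.length (p.take_spec hz)
      rw [SimpleGraph.Walk.length_append] at h''
      dsimp only at h
      exact (SimpleGraph.Walk.eq_of_length_eq_zero (p := p.takeUntil z hz) (by omega)).symm
    have hpy : ∀ z ∈ p.support, z ∈ c₂.support → z = y := by
      classical
      intro z hz hz₂
      have h := hmin (x, z) ⟨hx, hz₂⟩
      have h' := SimpleGraph.dist_le (p.takeUntil z hz)
      have h'' := congrArg SimpleGraph.Walk.length (p.take_spec hz)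
      rw [SimpleGraph.Walk.length_append] at h''
      dsimp only at h
      exact SimpleGraph.Walk.eq_of_length_eq_zero (p := p.dropUntil z hz) (by omega)
    refine ((HatGame.HalfWinning.of_mem_isCycle c₁ h₁ hx).of_isPath p hp hpx).winning
      (HatGame.HalfWinning.of_mem_isCycle c₂ h₂ hy) ?_
    rintro z (hz | hz) hz₂
    · have h := hmin (z, z) ⟨hz, hz₂⟩
      simp only [SimpleGraph.dist_self, Nat.le_zero] at h
      have hxy : x = y := hconn.dist_eq_zero_iff.1 h
      subst hxy
      exact hcact v w c₁ c₂ h₁ h₂ hne ⟨hz, hz₂⟩ ⟨hx, hy⟩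
    · exact hpy z hz hz₂
  exact ⟨hwin, le_csSup ⟨Fintype.card V, fun _ h => h.le_card⟩ hwin⟩
end
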